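/- arXiv:1411.0091 — 3 statements merged into one kernel-verified Lean document; each statement's English description precedes it below -/
import Mathlib

section
/- Fix integers p ≥ 1, q ≥ 1 and set n = p + q. Let Q(x) = Σ_{i=1}^p x_i² − Σ_{j=p+1}^n x_j², and consider on ℝⁿ the n−1 vector fields X_i = x_{i+1} ∂/∂x_i − x_i ∂/∂x_{i+1} for i ∈ {1, …, n−1} \ {p}, together with X_p = x_{p+1} ∂/∂x_p + x_p ∂/∂x_{p+1} (the infinitesimal generators of SO(p,q)). Let U be an open subset of {x ∈ ℝⁿ : Q(x) ≠ 0}. If a smooth function f : U → ℝ satisfies X_i f = 0 on U for all i = 1, …, n−1, then for every point a ∈ U there exist an open neighborhood V ⊆ U of a and a smooth function g : ℝ → ℝ such that f(x) = g(Q(x)) for all x ∈ V. -/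
/-- The action of a vector field `X` on a smooth function `f`:
`(X f)(q) = Df(q)(X(q))`. -/
noncomputable def vAct {n : ℕ} (X : (Fin n → ℝ) → (Fin n → ℝ))
    (f : (Fin n → ℝ) → ℝ) : (Fin n → ℝ) → ℝ :=
  fun q => fderiv ℝ f q (X q)

/-- The quadratic form of signature `(p, q)`:
`Q(x) = Σ_{i<p} x_i² − Σ_{p≤j} x_j²` (0-indexed). -/
noncomputable def sopqQ (p q : ℕ) (x : Fin (p + q) → ℝ) : ℝ :=
  ∑ i : Fin (p + q), (if (i : ℕ) < p then 1 else -1) * x i ^ 2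

/-- The infinitesimal generators of `SO(p, q)` (0-indexed): for `i + 1 < p + q`,
`X_i = x_{i+1} ∂_i − x_i ∂_{i+1}` except for `i + 1 = p`, where
`X_i = x_{i+1} ∂_i + x_i ∂_{i+1}` (the hyperbolic rotation). -/
noncomputable def sopqX (p q : ℕ) (i : Fin (p + q)) :
    (Fin (p + q) → ℝ) → (Fin (p + q) → ℝ) :=
  fun x k =>
    if h : (i : ℕ) + 1 < p + q then
      if (k : ℕ) = (i : ℕ) then x ⟨(i : ℕ) + 1, h⟩
      else if (k : ℕ) = (i : ℕ) + 1 then (if (i : ℕ) + 1 = p then 1 else -1) * x i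
      else 0
    else 0

/-- Half the `i`-th partial derivative of `sopqQ p q`. -/
noncomputable def sopqGrad (p q : ℕ) (x : Fin (p + q) → ℝ) (i : Fin (p + q)) : ℝ :=
  (if (i : ℕ) < p then 1 else -1) * x i

theorem hasFDerivAt_sopqQ (p q : ℕ) (x : Fin (p + q) → ℝ) :
    HasFDerivAt (sopqQ p q)
      (∑ i, (2 * sopqGrad p q x i) • ContinuousLinearMap.proj (R := ℝ) (φ := fun _ => ℝ) i) x := by
  unfold sopqQ
  refine HasFDerivAt.fun_sum fun i _ => ?_
  have h := ((hasFDerivAt_apply (𝕜 := ℝ) i x).pow 2).const_mul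
    (if (i : ℕ) < p then (1 : ℝ) else -1)
  refine h.congr_fderiv ?_
  ext v
  split_ifs with hi <;> simp [sopqGrad, hi]

theorem contDiff_sopqQ (p q : ℕ) {m : WithTop ℕ∞} : ContDiff ℝ m (sopqQ p q) := by
  unfold sopqQ
  fun_prop

theorem sopqQ_smul (p q : ℕ) (c : ℝ) (x : Fin (p + q) → ℝ) :
    sopqQ p q (c • x) = c ^ 2 * sopqQ p q x := by
  simp only [sopqQ, Finset.mul_sum, Pi.smul_apply, smul_eq_mul]
  exact Finset.sum_congr rfl fun i _ => by ring

theorem exists_sopqGrad_ne_zero {p q : ℕ} {x : Fin (p + q) → ℝ} (hx : sopqQ p q x ≠ 0) :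
    ∃ k, sopqGrad p q x k ≠ 0 := by
  by_contra! h
  refine hx (Finset.sum_eq_zero fun i _ => ?_)
  have := h i
  unfold sopqGrad at this
  rw [pow_two, ← mul_assoc, this, zero_mul]

theorem sopqX_eq (p q : ℕ) (i : Fin (p + q)) (h : (i : ℕ) + 1 < p + q) (x : Fin (p + q) → ℝ) :
    sopqX p q i x = x ⟨i + 1, h⟩ • Pi.single i (1 : ℝ) +
      ((if (i : ℕ) + 1 = p then 1 else -1) * x i) • Pi.single (⟨i + 1, h⟩ : Fin (p + q)) (1 : ℝ) := by
  ext k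
  simp only [sopqX, h, dif_pos, Pi.add_apply, Pi.smul_apply, Pi.single_apply, Fin.ext_iff,
    smul_eq_mul]
  split_ifs <;> first | omega | simp

/-- The consecutive generators force the derivative of an invariant to be proportional to the
gradient of the quadratic form wherever no coordinate vanishes. -/
theorem sopqGrad_mul_comm_of_ne_zero {p q : ℕ} {x : Fin (p + q) → ℝ} (hx : ∀ i, x i ≠ 0)
    (L : (Fin (p + q) → ℝ) →L[ℝ] ℝ)
    (hL : ∀ i : Fin (p + q), (i : ℕ) + 1 < p + q → L (sopqX p q i x) = 0)
    (i j : Fin (p + q)) :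
    sopqGrad p q x i * L (Pi.single j 1) = sopqGrad p q x j * L (Pi.single i 1) := by
  have hc : ∀ i, sopqGrad p q x i ≠ 0 := fun i => by
    unfold sopqGrad
    split_ifs <;> simpa using hx i
  have hstep : ∀ (k : ℕ) (h : k + 1 < p + q),
      sopqGrad p q x ⟨k + 1, h⟩ * L (Pi.single ⟨k, by omega⟩ 1) =
        sopqGrad p q x ⟨k, by omega⟩ * L (Pi.single ⟨k + 1, h⟩ 1) := fun k h => by
    have := hL ⟨k, by omega⟩ h
    rw [sopqX_eq p q ⟨k, by omega⟩ h, map_add, map_smul, map_smul, smul_eq_mul, smul_eq_mul] at this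
    simp only [sopqGrad]
    simp only at this
    split_ifs at this ⊢ <;> first | omega | linarith
  have hratio : ∀ (k : ℕ) (h : k < p + q),
      L (Pi.single ⟨k, h⟩ 1) / sopqGrad p q x ⟨k, h⟩ =
        L (Pi.single ⟨0, by omega⟩ 1) / sopqGrad p q x ⟨0, by omega⟩ := fun k => by
    induction k with
    | zero => exact fun _ => rfl
    | succ k ih =>
      intro h
      rw [← ih (by omega), div_eq_div_iff (hc _) (hc _)]
      linarith [hstep k h]
  have := (hratio j j.2).trans (hratio i i.2).symm
  rw [div_eq_div_iff (hc _) (hc _)] at this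
  linarith

theorem sopqGrad_mul_fderiv_comm {p q : ℕ} {U : Set (Fin (p + q) → ℝ)} (hU : IsOpen U)
    {f : (Fin (p + q) → ℝ) → ℝ} (hf : ContDiffOn ℝ 1 f U)
    (hinv : ∀ i : Fin (p + q), (i : ℕ) + 1 < p + q → ∀ x ∈ U, vAct (sopqX p q i) f x = 0)
    {x : Fin (p + q) → ℝ} (hx : x ∈ U) (i j : Fin (p + q)) :
    sopqGrad p q x i * fderiv ℝ f x (Pi.single j 1) =
      sopqGrad p q x j * fderiv ℝ f x (Pi.single i 1) := by
  have hD : Dense (Set.pi Set.univ fun _ : Fin (p + q) => ({0}ᶜ : Set ℝ)) :=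
    dense_pi Set.univ fun _ _ => dense_compl_singleton 0
  have hcont : ∀ i j : Fin (p + q), ContinuousOn
      (fun x => sopqGrad p q x i * fderiv ℝ f x (Pi.single j 1)) U := fun i j => by
    have h1 : Continuous fun x => sopqGrad p q x i := by
      unfold sopqGrad
      fun_prop
    exact h1.continuousOn.mul
      ((hf.continuousOn_fderiv_of_isOpen hU le_rfl).clm_apply continuousOn_const)
  refine Set.EqOn.of_subset_closure (fun y hy => ?_) (hcont i j) (hcont j i)
    Set.inter_subset_left (hD.open_subset_closure_inter hU) hx
  exact sopqGrad_mul_comm_of_ne_zero (fun k => by simpa using hy.2 k) _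
    (fun k hk => hinv k hk y hy.1) i j

/-- The derivative of a joint invariant vanishes on the kernel of the derivative of `sopqQ`. -/
theorem fderiv_eq_zero_of_fderiv_sopqQ_eq_zero {p q : ℕ} {U : Set (Fin (p + q) → ℝ)}
    (hU : IsOpen U) {f : (Fin (p + q) → ℝ) → ℝ} (hf : ContDiffOn ℝ 1 f U)
    (hinv : ∀ i : Fin (p + q), (i : ℕ) + 1 < p + q → ∀ x ∈ U, vAct (sopqX p q i) f x = 0)
    {x : Fin (p + q) → ℝ} (hx : x ∈ U) (hQ : sopqQ p q x ≠ 0) {v : Fin (p + q) → ℝ}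
    (hv : fderiv ℝ (sopqQ p q) x v = 0) : fderiv ℝ f x v = 0 := by
  obtain ⟨k, hk⟩ := exists_sopqGrad_ne_zero hQ
  have hv' : ∑ i, sopqGrad p q x i * v i = 0 := by
    rw [(hasFDerivAt_sopqQ p q x).fderiv] at hv
    simpa [mul_assoc, ← Finset.mul_sum] using hv
  have hsum : fderiv ℝ f x v = ∑ i, v i * fderiv ℝ f x (Pi.single i 1) := by
    conv_lhs => rw [pi_eq_sum_univ' v]
    simp
  refine (mul_eq_zero.mp ?_).resolve_left hk
  calc sopqGrad p q x k * fderiv ℝ f x v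
      = ∑ i, sopqGrad p q x i * v i * fderiv ℝ f x (Pi.single k 1) := by
        rw [hsum, Finset.mul_sum]
        refine Finset.sum_congr rfl fun i _ => ?_
        linear_combination v i * sopqGrad_mul_fderiv_comm hU hf hinv hx k i
    _ = 0 := by rw [← Finset.sum_mul, hv', zero_mul]

/-- A function smooth near `t₀` agrees near `t₀` with a globally smooth function. -/
theorem exists_contDiff_eqOn_ball {h : ℝ → ℝ} {t₀ δ : ℝ} (hδ : 0 < δ)
    (hh : ContDiffOn ℝ (⊤ : ℕ∞) h (Metric.ball t₀ δ)) :
    ∃ g : ℝ → ℝ, ContDiff ℝ (⊤ : ℕ∞) g ∧ Set.EqOn g h (Metric.ball t₀ (δ / 3)) := by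
  let b : ContDiffBump t₀ := ⟨δ / 3, δ / 2, by positivity, by linarith⟩
  refine ⟨fun t => b t * h t, contDiff_iff_contDiffAt.2 fun t => ?_, fun t ht => ?_⟩
  · by_cases ht : t ∈ Metric.ball t₀ δ
    · exact b.contDiff.contDiffAt.mul (hh.contDiffAt (Metric.isOpen_ball.mem_nhds ht))
    · have hsupp : t ∉ tsupport b := by
        rw [b.tsupport_eq]
        exact fun h' => ht (Metric.closedBall_subset_ball (by simp only [b]; linarith) h')
      refine (contDiffAt_const (c := (0 : ℝ))).congr_of_eventuallyEq ?_
      filter_upwards [notMem_tsupport_iff_eventuallyEq.1 hsupp] with s hs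
      simp [hs]
  · simp only
    rw [b.one_of_mem_closedBall (Metric.ball_subset_closedBall ht), one_mul]

/-- A joint invariant of the infinitesimal generators of `SO(p, q)` on an open
set where `Q ≠ 0` is locally a smooth function of `Q`. -/
theorem sopq_joint_invariant (p q : ℕ) (hp : 1 ≤ p) (hq : 1 ≤ q)
    (U : Set (Fin (p + q) → ℝ)) (hU : IsOpen U)
    (hUQ : ∀ x ∈ U, sopqQ p q x ≠ 0)
    (f : (Fin (p + q) → ℝ) → ℝ) (hf : ContDiffOn ℝ (⊤ : ℕ∞) f U)
    (hinv : ∀ i : Fin (p + q), (i : ℕ) + 1 < p + q →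
      ∀ x ∈ U, vAct (sopqX p q i) f x = 0) :
    ∀ a ∈ U, ∃ V : Set (Fin (p + q) → ℝ), IsOpen V ∧ a ∈ V ∧ V ⊆ U ∧
      ∃ g : ℝ → ℝ, ContDiff ℝ (⊤ : ℕ∞) g ∧ ∀ x ∈ V, f x = g (sopqQ p q x) := by
  intro a ha
  have hQa := hUQ a ha
  have hQc : Continuous (sopqQ p q) := (contDiff_sopqQ p q (m := 0)).continuous
  have hdivc : ContinuousAt (fun z : ℝ × (Fin (p + q) → ℝ) => z.1 / sopqQ p q z.2)
      (sopqQ p q a, a) :=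
    continuousAt_fst.div (hQc.continuousAt.comp continuousAt_snd) hQa
  have hrescale : ContinuousAt
      (fun z : ℝ × (Fin (p + q) → ℝ) => √(z.1 / sopqQ p q z.2) • z.2) (sopqQ p q a, a) :=
    (Real.continuous_sqrt.continuousAt.comp hdivc).smul continuousAt_snd
  have hev : ∀ᶠ z : ℝ × (Fin (p + q) → ℝ) in nhds (sopqQ p q a, a),
      0 < z.1 / sopqQ p q z.2 ∧ √(z.1 / sopqQ p q z.2) • z.2 ∈ U := by
    refine (hdivc.eventually (lt_mem_nhds ?_)).and (hrescale.eventually (hU.mem_nhds ?_))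
    · simp [div_self hQa]
    · simpa [div_self hQa] using ha
  obtain ⟨δ, hδ, hball⟩ := Metric.eventually_nhds_iff_ball.1 hev
  replace hball : ∀ t ∈ Metric.ball (sopqQ p q a) δ, ∀ x ∈ Metric.ball a δ,
      0 < t / sopqQ p q x ∧ √(t / sopqQ p q x) • x ∈ U := fun t ht x hx =>
    hball (t, x) (by rw [← ball_prod_same]; exact ⟨ht, hx⟩)
  have hconst : ∀ t ∈ Metric.ball (sopqQ p q a) δ, ∀ x ∈ Metric.ball a δ,
      f (√(t / sopqQ p q x) • x) = f (√(t / sopqQ p q a) • a) := by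
    intro t ht x hx
    set φ : (Fin (p + q) → ℝ) → (Fin (p + q) → ℝ) := fun x => √(t / sopqQ p q x) • x with hφ
    have hderiv : ∀ y ∈ Metric.ball a δ, HasFDerivAt (𝕜 := ℝ) (fun y => f (φ y)) 0 y := by
      intro y hy
      have hQy : sopqQ p q y ≠ 0 := fun h => by simpa [h] using (hball t ht y hy).1
      have hφd : DifferentiableAt ℝ φ y :=
        (((contDiffAt_const.div (contDiff_sopqQ p q (m := 1)).contDiffAt hQy).sqrt
          (hball t ht y hy).1.ne').smul contDiffAt_id).differentiableAt one_ne_zero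
      have hfd : DifferentiableAt ℝ f (φ y) :=
        (hf.contDiffAt (hU.mem_nhds (hball t ht y hy).2)).differentiableAt (by simp)
      have hQφ : HasFDerivAt (𝕜 := ℝ) (fun y => sopqQ p q (φ y)) 0 y := by
        refine (hasFDerivAt_const t y).congr_of_eventuallyEq ?_
        filter_upwards [Metric.isOpen_ball.mem_nhds hy] with w hw
        have hQw : sopqQ p q w ≠ 0 := fun h => by simpa [h] using (hball t ht w hw).1
        rw [hφ, sopqQ_smul, Real.sq_sqrt (hball t ht w hw).1.le, div_mul_cancel₀ _ hQw]
      have hcomp := ((hasFDerivAt_sopqQ p q (φ y)).differentiableAt.hasFDerivAt.comp y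
        hφd.hasFDerivAt).unique hQφ
      refine (hfd.hasFDerivAt.comp y hφd.hasFDerivAt).congr_fderiv ?_
      ext1 v
      exact fderiv_eq_zero_of_fderiv_sopqQ_eq_zero hU (hf.of_le (by simp)) hinv
        (hball t ht y hy).2 (hUQ _ (hball t ht y hy).2) (DFunLike.congr_fun hcomp v)
    have := (convex_ball a δ).is_const_of_fderivWithin_eq_zero (𝕜 := ℝ) (f := fun y => f (φ y))
      (fun y hy => (hderiv y hy).differentiableAt.differentiableWithinAt)
      (fun y hy => by
        rw [fderivWithin_of_isOpen Metric.isOpen_ball hy, (hderiv y hy).fderiv])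
      hx (Metric.mem_ball_self hδ)
    exact this
  obtain ⟨g, hg, hgeq⟩ := exists_contDiff_eqOn_ball (h := fun t => f (√(t / sopqQ p q a) • a)) hδ
    (fun t ht => by
      obtain ⟨hpos, hmem⟩ := hball t ht a (Metric.mem_ball_self hδ)
      refine ((hf.contDiffAt (hU.mem_nhds hmem)).comp t ?_).contDiffWithinAt
      exact ((contDiffAt_id.div_const _).sqrt hpos.ne').smul contDiffAt_const)
  refine ⟨U ∩ (Metric.ball a δ ∩ sopqQ p q ⁻¹' Metric.ball (sopqQ p q a) (δ / 3)),
    hU.inter (Metric.isOpen_ball.inter (Metric.isOpen_ball.preimage hQc)),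
    ⟨ha, Metric.mem_ball_self hδ, Metric.mem_ball_self (by positivity)⟩,
    Set.inter_subset_left, g, hg, ?_⟩
  rintro x ⟨hxU, hxa, hxQ⟩
  rw [hgeq hxQ]
  simp only
  rw [← hconst _ (Metric.ball_subset_ball (by linarith) hxQ) x hxa,
    div_self (hUQ x hxU), Real.sqrt_one, one_smul]
end

section
/- Let U be an open subset of {(x,y,z) ∈ ℝ³ : x ≠ 0}, and consider on U the sl(2)-triple of vector fields V₊ = 2y ∂/∂x + z ∂/∂y, V₀ = −2x ∂/∂x + 2z ∂/∂z, and V₋ = x ∂/∂y + 2y ∂/∂z. If a smooth function f : U → ℝ satisfies V₊ f = 0, V₀ f = 0 and V₋ f = 0 on U, then for every point p ∈ U there exist an open neighborhood V ⊆ U of p and a smooth function g : ℝ → ℝ such that f(x,y,z) = g(xz − y²) for all (x,y,z) ∈ V. That is, the basic joint invariant of these three vector fields is xz − y². -/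
/-- A function smooth on a ball agrees on a smaller concentric ball with a globally smooth one. -/
theorem exists_contDiff_eqOn_ball_s9 {h : ℝ → ℝ} {c r s : ℝ} (hs : 0 < s) (hsr : s < r)
    (hh : ContDiffOn ℝ (⊤ : ℕ∞) h (Metric.ball c r)) :
    ∃ g : ℝ → ℝ, ContDiff ℝ (⊤ : ℕ∞) g ∧ Set.EqOn g h (Metric.ball c s) := by
  let χ : ContDiffBump c := ⟨s, (s + r) / 2, hs, by linarith⟩
  refine ⟨fun w => χ w * h w, ?_, fun w hw => ?_⟩
  · rw [contDiff_iff_contDiffAt]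
    intro w
    by_cases hw : w ∈ Metric.ball c r
    · exact χ.contDiffAt.mul (hh.contDiffAt (Metric.isOpen_ball.mem_nhds hw))
    · have hw' : w ∉ tsupport χ := by
        rw [χ.tsupport_eq]
        simp only [Metric.mem_ball, Metric.mem_closedBall, not_lt, not_le] at hw ⊢
        change (s + r) / 2 < _
        linarith
      refine (contDiffAt_const (c := (0 : ℝ))).congr_of_eventuallyEq ?_
      filter_upwards [notMem_tsupport_iff_eventuallyEq.mp hw'] with v hv
      simp [hv]
  · simp [χ.one_of_mem_closedBall (Metric.ball_subset_closedBall hw)]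

/-- The point with first two coordinates `u 0`, `u 1` at which `xz − y²` takes the value `u 2`. -/
noncomputable def discrChart (u : Fin 3 → ℝ) : Fin 3 → ℝ :=
  ![u 0, u 1, (u 2 + u 1 ^ 2) / u 0]

theorem discrChart_apply_discr {q : Fin 3 → ℝ} (hq : q 0 ≠ 0) :
    discrChart ![q 0, q 1, q 0 * q 2 - q 1 ^ 2] = q := by
  ext i
  fin_cases i
  · simp [discrChart]
  · simp [discrChart]
  · simp [discrChart, hq]

theorem contDiffAt_discrChart {u : Fin 3 → ℝ} (hu : u 0 ≠ 0) :
    ContDiffAt ℝ (⊤ : ℕ∞) discrChart u := by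
  have hc : ∀ i : Fin 3, ContDiffAt ℝ (⊤ : ℕ∞) (fun v : Fin 3 → ℝ => v i) u :=
    fun i => (contDiff_apply ℝ ℝ i).contDiffAt
  rw [contDiffAt_pi]
  intro i
  fin_cases i
  · exact hc 0
  · exact hc 1
  · exact ((hc 2).add ((hc 1).pow 2)).div (hc 0) hu

/-- Moving in the first two coordinates of the chart, a function annihilated by
`−2x∂x + 2z∂z` and `x∂y + 2y∂z` has zero derivative. -/
theorem hasDerivAt_comp_discrChart {f : (Fin 3 → ℝ) → ℝ} {a b m n w t : ℝ}
    (hx : a + t * m ≠ 0)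
    (hf : DifferentiableAt ℝ f (discrChart ![a + t * m, b + t * n, w]))
    (hzero : vAct (fun x => ![-2 * x 0, 0, 2 * x 2]) f
      (discrChart ![a + t * m, b + t * n, w]) = 0)
    (hminus : vAct (fun x => ![0, x 0, 2 * x 1]) f
      (discrChart ![a + t * m, b + t * n, w]) = 0) :
    HasDerivAt (fun s : ℝ => f (discrChart ![a + s * m, b + s * n, w])) 0 t := by
  set x := a + t * m with hxdef
  set y := b + t * n with hydef
  have hX : HasDerivAt (fun s : ℝ => a + s * m) m t := by
    simpa using ((hasDerivAt_id t).mul_const m).const_add a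
  have hY : HasDerivAt (fun s : ℝ => b + s * n) n t := by
    simpa using ((hasDerivAt_id t).mul_const n).const_add b
  have hγ : HasDerivAt (fun s : ℝ => discrChart ![a + s * m, b + s * n, w])
      ((n / x) • ![0, x, 2 * y] - (m / (2 * x)) • ![-2 * x, 0, 2 * ((w + y ^ 2) / x)]) t := by
    rw [hasDerivAt_pi]
    intro i
    fin_cases i
    · refine hX.congr_deriv ?_
      simp
      field_simp
    · refine hY.congr_deriv ?_
      simp
      field_simp
    · refine (((hY.pow 2).const_add w).div hX hx).congr_deriv ?_
      simp [← hxdef, ← hydef]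
      field_simp
  refine (hf.hasFDerivAt.comp_hasDerivAt t hγ).congr_deriv ?_
  have h₀ : fderiv ℝ f (discrChart ![x, y, w]) ![-2 * x, 0, 2 * ((w + y ^ 2) / x)] = 0 := hzero
  have h₁ : fderiv ℝ f (discrChart ![x, y, w]) ![0, x, 2 * y] = 0 := hminus
  rw [map_sub, map_smul, map_smul, h₀, h₁]
  simp

/-- A joint invariant of the `sl(2)`-triple `V₊ = 2y∂x + z∂y`,
`V₀ = −2x∂x + 2z∂z`, `V₋ = x∂y + 2y∂z` on `ℝ³` (where `x ≠ 0`) is locally a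
smooth function of `xz − y²`. -/
theorem sl2_joint_invariant (U : Set (Fin 3 → ℝ)) (hU : IsOpen U)
    (hU' : ∀ p ∈ U, p 0 ≠ 0)
    (f : (Fin 3 → ℝ) → ℝ) (hf : ContDiffOn ℝ (⊤ : ℕ∞) f U)
    (hplus : ∀ q ∈ U, vAct (fun x => ![2 * x 1, x 2, 0]) f q = 0)
    (hzero : ∀ q ∈ U, vAct (fun x => ![-2 * x 0, 0, 2 * x 2]) f q = 0)
    (hminus : ∀ q ∈ U, vAct (fun x => ![0, x 0, 2 * x 1]) f q = 0) :
    ∀ p ∈ U, ∃ V : Set (Fin 3 → ℝ), IsOpen V ∧ p ∈ V ∧ V ⊆ U ∧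
      ∃ g : ℝ → ℝ, ContDiff ℝ (⊤ : ℕ∞) g ∧
        ∀ q ∈ V, f q = g (q 0 * q 2 - q 1 ^ 2) := by
  intro p hp
  let Ψ : (Fin 3 → ℝ) → (Fin 3 → ℝ) := fun q => ![q 0, q 1, q 0 * q 2 - q 1 ^ 2]
  have hΨ : Continuous Ψ := by
    refine continuous_pi fun i => ?_
    fin_cases i
    · exact continuous_apply 0
    · exact continuous_apply 1
    · change Continuous fun q : Fin 3 → ℝ => q 0 * q 2 - q 1 ^ 2
      fun_prop
  have hnhds : discrChart ⁻¹' U ∈ nhds (Ψ p) := by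
    refine (contDiffAt_discrChart (u := Ψ p) (hU' p hp)).continuousAt.preimage_mem_nhds ?_
    rw [discrChart_apply_discr (hU' p hp)]
    exact hU.mem_nhds hp
  obtain ⟨ε, hε, hball⟩ := Metric.mem_nhds_iff.mp hnhds
  have hmem : ∀ {x y w : ℝ}, |x - p 0| < ε → |y - p 1| < ε →
      |w - (p 0 * p 2 - p 1 ^ 2)| < ε → discrChart ![x, y, w] ∈ U := by
    intro x y w hx hy hw
    refine hball ?_
    rw [Metric.mem_ball, dist_pi_lt_iff hε]
    intro i
    fin_cases i
    · exact hx
    · exact hy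
    · exact hw
  have hsmooth : ContDiffOn ℝ (⊤ : ℕ∞) (fun w : ℝ => f (discrChart ![p 0, p 1, w]))
      (Metric.ball (p 0 * p 2 - p 1 ^ 2) ε) := by
    intro w hw
    have hU₁ : discrChart ![p 0, p 1, w] ∈ U := hmem (by simpa) (by simpa) hw
    have hline : ContDiffAt ℝ (⊤ : ℕ∞) (fun w : ℝ => (![p 0, p 1, w] : Fin 3 → ℝ)) w := by
      rw [contDiffAt_pi]
      intro i
      fin_cases i
      · exact contDiffAt_const
      · exact contDiffAt_const
      · exact contDiffAt_id
    have h₁ : ContDiffAt ℝ (⊤ : ℕ∞) (fun w : ℝ => discrChart ![p 0, p 1, w]) w :=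
      ContDiffAt.comp (g := discrChart) w
        (contDiffAt_discrChart (u := ![p 0, p 1, w]) (hU' p hp)) hline
    exact ((hf.contDiffAt (hU.mem_nhds hU₁)).comp w h₁).contDiffWithinAt
  obtain ⟨g, hg, hgeq⟩ := exists_contDiff_eqOn_ball_s9 (half_pos hε) (half_lt_self hε) hsmooth
  refine ⟨U ∩ Ψ ⁻¹' Metric.ball (Ψ p) (ε / 2),
    hU.inter (Metric.isOpen_ball.preimage hΨ), ⟨hp, Metric.mem_ball_self (half_pos hε)⟩,
    Set.inter_subset_left, g, hg, ?_⟩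
  rintro q ⟨hqU, hq⟩
  rw [Set.mem_preimage, Metric.mem_ball, dist_pi_lt_iff (half_pos hε)] at hq
  have hq0 : |q 0 - p 0| < ε / 2 := hq 0
  have hq1 : |q 1 - p 1| < ε / 2 := hq 1
  have hq2 : |q 0 * q 2 - q 1 ^ 2 - (p 0 * p 2 - p 1 ^ 2)| < ε / 2 := hq 2
  rw [hgeq hq2]
  set w := q 0 * q 2 - q 1 ^ 2
  have hderiv : ∀ t ∈ Set.Icc (0 : ℝ) 1, HasDerivAt (fun s : ℝ =>
      f (discrChart ![p 0 + s * (q 0 - p 0), p 1 + s * (q 1 - p 1), w])) 0 t := by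
    intro t ht
    have hscale : ∀ {a d : ℝ}, |d| < ε / 2 → |a + t * d - a| < ε := by
      intro a d hd
      rw [add_sub_cancel_left, abs_mul, abs_of_nonneg ht.1]
      nlinarith [mul_le_mul_of_nonneg_right ht.2 (abs_nonneg d)]
    have hU₁ := hmem (hscale (a := p 0) hq0) (hscale (a := p 1) hq1)
      (hq2.trans (half_lt_self hε))
    exact hasDerivAt_comp_discrChart (hU' _ hU₁)
      ((hf.contDiffAt (hU.mem_nhds hU₁)).differentiableAt (by simp))
      (hzero _ hU₁) (hminus _ hU₁)
  have hconst := constant_of_has_deriv_right_zero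
    (fun t ht => (hderiv t ht).continuousAt.continuousWithinAt)
    (fun t ht => (hderiv t (Set.Ico_subset_Icc_self ht)).hasDerivWithinAt)
    1 (Set.right_mem_Icc.mpr zero_le_one)
  simp only [one_mul, add_sub_cancel, zero_mul, add_zero] at hconst
  change f q = f (discrChart ![p 0, p 1, w])
  rw [← hconst, discrChart_apply_discr (hU' q hqU)]
end

section
/- On ℝ⁸ with coordinates (x₁, …, x₈), consider the eight vector fields giving the coadjoint representation of sl(3,ℝ) (written as component lists with respect to ∂/∂x₁, …, ∂/∂x₈): X₁ = (0, −x₂, −2x₃, x₄, 0, −x₆, 2x₇, x₈), X₂ = (x₂, 0, 0, x₅−x₁, −x₂, −x₃, x₈, 0), X₃ = (2x₃, 0, 0, x₆, x₃, 0, −x₁, −x₂), X₄ = (−x₄, −x₅+x₁, −x₆, 0, x₄, 0, 0, x₇), X₅ = (0, x₂, −x₃, −x₄, 0, −2x₆, x₇, 2x₈), X₆ = (x₆, x₃, 0, 0, 2x₆, 0, −x₄, −x₅), X₇ = (−2x₇, −x₈, x₁, 0, −x₇, x₄, 0, 0), X₈ = (−x₈, 0, x₂, −x₇, −2x₈, x₅,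 0, 0). Then the cubic polynomial I₂ = 2x₁³ − 3x₅x₁² + 9x₂x₄x₁ − 3x₁x₅² − 18x₁x₈x₆ + 9x₇x₃x₁ + 2x₅³ + 9x₅x₈x₆ − 18x₇x₅x₃ + 9x₅x₂x₄ + 27x₇x₆x₂ + 27x₄x₃x₈ is a joint invariant: X_k I₂ = 0 on ℝ⁸ for every k = 1, …, 8. -/
/-- The eight fundamental vector fields of the coadjoint representation of
`sl(3, ℝ)` on `ℝ⁸` (0-indexed coordinates `x 0, …, x 7` for `x₁, …, x₈`). -/
noncomputable def sl3CoadX : Fin 8 → (Fin 8 → ℝ) → (Fin 8 → ℝ) :=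
  ![fun x => ![0, -x 1, -2 * x 2, x 3, 0, -x 5, 2 * x 6, x 7],
    fun x => ![x 1, 0, 0, x 4 - x 0, -x 1, -x 2, x 7, 0],
    fun x => ![2 * x 2, 0, 0, x 5, x 2, 0, -x 0, -x 1],
    fun x => ![-x 3, -x 4 + x 0, -x 5, 0, x 3, 0, 0, x 6],
    fun x => ![0, x 1, -x 2, -x 3, 0, -2 * x 5, x 6, 2 * x 7],
    fun x => ![x 5, x 2, 0, 0, 2 * x 5, 0, -x 3, -x 4],
    fun x => ![-2 * x 6, -x 7, x 0, 0, -x 6, x 3, 0, 0],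
    fun x => ![-x 7, 0, x 1, -x 6, -2 * x 7, x 4, 0, 0]]

/-- The directional derivative of `I₂` at `x` along `v`. -/
theorem fderiv_sl3_cubic_apply (x v : Fin 8 → ℝ) :
    fderiv ℝ (fun x : Fin 8 → ℝ => 2 * x 0 ^ 3 - 3 * x 4 * x 0 ^ 2 + 9 * x 1 * x 3 * x 0 -
          3 * x 0 * x 4 ^ 2 - 18 * x 0 * x 7 * x 5 + 9 * x 6 * x 2 * x 0 +
          2 * x 4 ^ 3 + 9 * x 4 * x 7 * x 5 - 18 * x 6 * x 4 * x 2 +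
          9 * x 4 * x 1 * x 3 + 27 * x 6 * x 5 * x 1 + 27 * x 3 * x 2 * x 7) x v =
      (6 * x 0 ^ 2 - 6 * x 4 * x 0 + 9 * x 1 * x 3 - 3 * x 4 ^ 2 - 18 * x 7 * x 5 +
          9 * x 6 * x 2) * v 0 +
        (9 * x 3 * x 0 + 9 * x 4 * x 3 + 27 * x 6 * x 5) * v 1 +
        (9 * x 6 * x 0 - 18 * x 6 * x 4 + 27 * x 3 * x 7) * v 2 +
        (9 * x 1 * x 0 + 9 * x 4 * x 1 + 27 * x 2 * x 7) * v 3 +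
        (-3 * x 0 ^ 2 - 6 * x 0 * x 4 + 6 * x 4 ^ 2 + 9 * x 7 * x 5 - 18 * x 6 * x 2 +
          9 * x 1 * x 3) * v 4 +
        (-18 * x 0 * x 7 + 9 * x 4 * x 7 + 27 * x 6 * x 1) * v 5 +
        (9 * x 2 * x 0 - 18 * x 4 * x 2 + 27 * x 5 * x 1) * v 6 +
        (-18 * x 0 * x 5 + 9 * x 4 * x 5 + 27 * x 3 * x 2) * v 7 := by
  have h (i : Fin 8) := hasFDerivAt_apply (𝕜 := ℝ) i x
  have key := (((((((((((((h 0).pow 3).const_mul 2).sub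
    (((h 4).const_mul 3).mul ((h 0).pow 2))).add
    ((((h 1).const_mul 9).mul (h 3)).mul (h 0))).sub
    (((h 0).const_mul 3).mul ((h 4).pow 2))).sub
    ((((h 0).const_mul 18).mul (h 7)).mul (h 5))).add
    ((((h 6).const_mul 9).mul (h 2)).mul (h 0))).add
    (((h 4).pow 3).const_mul 2)).add
    ((((h 4).const_mul 9).mul (h 7)).mul (h 5))).sub
    ((((h 6).const_mul 18).mul (h 4)).mul (h 2))).add
    ((((h 4).const_mul 9).mul (h 1)).mul (h 3))).add
    ((((h 6).const_mul 27).mul (h 5)).mul (h 1))).add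
    ((((h 3).const_mul 27).mul (h 2)).mul (h 7))
  refine (DFunLike.congr_fun key.fderiv v).trans ?_
  simp
  ring

/-- The cubic polynomial
`I₂ = 2x₁³ − 3x₅x₁² + 9x₂x₄x₁ − 3x₁x₅² − 18x₁x₈x₆ + 9x₇x₃x₁ + 2x₅³ + 9x₅x₈x₆
      − 18x₇x₅x₃ + 9x₅x₂x₄ + 27x₇x₆x₂ + 27x₄x₃x₈`
is a joint invariant of the coadjoint representation of `sl(3, ℝ)`. -/
theorem sl3_coadjoint_invariant_I2 :
    ∀ k : Fin 8, ∀ x : Fin 8 → ℝ,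
      vAct (sl3CoadX k)
        (fun x => 2 * x 0 ^ 3 - 3 * x 4 * x 0 ^ 2 + 9 * x 1 * x 3 * x 0 -
          3 * x 0 * x 4 ^ 2 - 18 * x 0 * x 7 * x 5 + 9 * x 6 * x 2 * x 0 +
          2 * x 4 ^ 3 + 9 * x 4 * x 7 * x 5 - 18 * x 6 * x 4 * x 2 +
          9 * x 4 * x 1 * x 3 + 27 * x 6 * x 5 * x 1 + 27 * x 3 * x 2 * x 7) x
        = 0 := by
  intro k x
  rw [vAct, fderiv_sl3_cubic_apply]
  fin_cases k <;> simp [sl3CoadX] <;> ring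
end
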